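/- Let V be a finite type and μ : V → V → ℝ a symmetric function with 0 ≤ μ x y for all x, y, and define the Dirichlet energy of f : V → ℝ by E(f) = (1/2) * ∑_{x ∈ V} ∑_{y ∈ V} μ x y * (f x - f y)^2. Let m ≥ 1, let g : Fin m → V → ℝ, and let f : V → ℝ be the pointwise minimum f v = min_{i : Fin m} g i v. Then E(f) ≤ ∑_{i : Fin m} E(g i). -/

import Mathlib

theorem sq_ciInf_sub_ciInf_le_sum {ι : Type*} [Fintype ι] [Nonempty ι] (a b : ι → ℝ) :
    ((⨅ i, a i) - ⨅ i, b i) ^ 2 ≤ ∑ i, (a i - b i) ^ 2 := by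
  wlog hab : (⨅ i, a i) ≤ ⨅ i, b i generalizing a b
  · have h := this b a (le_of_not_ge hab)
    rw [← neg_sub, neg_sq]
    exact h.trans_eq (Finset.sum_congr rfl fun i _ => by ring)
  obtain ⟨i, hi⟩ := exists_eq_ciInf_of_finite (f := a)
  have hb : (⨅ j, b j) ≤ b i := ciInf_le (Set.finite_range b).bddBelow i
  calc ((⨅ i, a i) - ⨅ i, b i) ^ 2 ≤ (a i - b i) ^ 2 := by
        rw [← hi] at hab ⊢
        nlinarith
    _ ≤ ∑ i, (a i - b i) ^ 2 :=
        Finset.single_le_sum (f := fun i => (a i - b i) ^ 2)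
          (fun i _ => sq_nonneg _) (Finset.mem_univ i)

/-- Inequality (3.1): the Dirichlet energy of a pointwise minimum is at most the
sum of the Dirichlet energies. -/
theorem energy_min_le_sum
    {V : Type*} [Fintype V] (μ : V → V → ℝ)
    (hsym : ∀ x y, μ x y = μ y x) (hnonneg : ∀ x y, 0 ≤ μ x y)
    (E : (V → ℝ) → ℝ)
    (hE : ∀ f, E f = (1 / 2) * ∑ x, ∑ y, μ x y * (f x - f y) ^ 2)
    (m : ℕ) (hm : 1 ≤ m) (g : Fin m → V → ℝ) (f : V → ℝ)
    (hf : ∀ v, f v = ⨅ i, g i v) :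
    E f ≤ ∑ i, E (g i) := by
  have : Nonempty (Fin m) := ⟨⟨0, hm⟩⟩
  simp only [hE]
  rw [← Finset.mul_sum, Finset.sum_comm (s := (Finset.univ : Finset (Fin m)))]
  refine mul_le_mul_of_nonneg_left (Finset.sum_le_sum fun x _ => ?_) (by norm_num)
  rw [Finset.sum_comm]
  refine Finset.sum_le_sum fun y _ => ?_
  rw [← Finset.mul_sum, hf, hf]
  exact mul_le_mul_of_nonneg_left (sq_ciInf_sub_ciInf_le_sum _ _) (hnonneg x y)
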